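/- Minkowski-type theorem for almost periodic patterns: let Γ ⊂ ℤ^n be an almost periodic pattern with D(Γ) > 0, let k ≥ 1 be an integer, and let S ⊂ ℝ^n be a centrally symmetric convex body with Leb(S) > 4^n·k. If there is ρ_0 > 0 such that ρ_Γ(v) < ρ_0 for every nonzero v ∈ S ∩ ℤ^n, then ρ_0 ≥ (1/k)·(1 − 1/(D(Γ)(2k+1))). -/

import Mathlib

open Filter MeasureTheory
open scoped BigOperators

noncomputable section

/-- The projection `p : ℝ → ℤ`: the unique `k` with `k - 1/2 < x ≤ k + 1/2`. -/
def roundHalf (x : ℝ) : ℤ := ⌈x - 1/2⌉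

/-- Coercion of an integer vector to a real vector. -/
def intVec {n : ℕ} (v : Fin n → ℤ) : Fin n → ℝ := fun i => (v i : ℝ)

/-- The set of integer points of `ℝ^n`. -/
def intPoints (n : ℕ) : Set (Fin n → ℝ) := Set.range (intVec (n := n))

/-- The coordinatewise projection `π : ℝ^n → ℤ^n`. -/
def discretize {n : ℕ} (x : Fin n → ℝ) : Fin n → ℤ := fun i => roundHalf (x i)

/-- `π` viewed as a self-map of `ℝ^n`. -/
def discretizeR {n : ℕ} (x : Fin n → ℝ) : Fin n → ℝ := intVec (discretize x)

/-- The image of a set `Γ` under the discretization `P̂` of the matrix `P`. -/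
def PhatImg {n : ℕ} (P : Matrix (Fin n) (Fin n) ℝ) (Γ : Set (Fin n → ℝ)) :
    Set (Fin n → ℝ) :=
  (fun x => discretizeR (P.mulVec x)) '' Γ

/-- The uniform `R`-density `D_R^+`. Balls are sup-norm balls. -/
def DRplus {n : ℕ} (Γ : Set (Fin n → ℝ)) (R : ℝ) : ℝ :=
  ⨆ x : Fin n → ℝ,
    ((Metric.ball x R ∩ Γ).ncard : ℝ) / ((Metric.ball x R ∩ intPoints n).ncard : ℝ)

/-- Relatively dense with parameter `R₀`. -/
def RelativelyDenseWith {n : ℕ} (Γ : Set (Fin n → ℝ)) (R₀ : ℝ) : Prop :=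
  ∀ x : Fin n → ℝ, ∀ r, R₀ ≤ r → (Metric.ball x r ∩ Γ).Nonempty

def RelativelyDense {n : ℕ} (Γ : Set (Fin n → ℝ)) : Prop :=
  ∃ R₀ > 0, RelativelyDenseWith Γ R₀

/-- Uniformly discrete with parameter `r₀`. -/
def UniformlyDiscreteWith {n : ℕ} (Γ : Set (Fin n → ℝ)) (r₀ : ℝ) : Prop :=
  ∀ x : Fin n → ℝ, ∀ r, 0 < r → r ≤ r₀ → (Metric.ball x r ∩ Γ).Subsingleton

def UniformlyDiscrete {n : ℕ} (Γ : Set (Fin n → ℝ)) : Prop :=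
  ∃ r₀ > 0, UniformlyDiscreteWith Γ r₀

def Delone {n : ℕ} (Γ : Set (Fin n → ℝ)) : Prop :=
  RelativelyDense Γ ∧ UniformlyDiscrete Γ

/-- The translateSet `Γ + v`. -/
def translateSet {n : ℕ} (Γ : Set (Fin n → ℝ)) (v : Fin n → ℝ) : Set (Fin n → ℝ) :=
  (· + v) '' Γ

/-- `N` is a set of `ε`-translations of `Γ` with radius `Rε`. -/
def IsEpsTranslationSet {n : ℕ} (Γ : Set (Fin n → ℝ)) (ε Rε : ℝ)
    (N : Set (Fin n → ℝ)) : Prop :=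
  N ⊆ intPoints n ∧ RelativelyDense N ∧
    ∀ R, Rε ≤ R → ∀ v ∈ N, DRplus (symmDiff (translateSet Γ v) Γ) R < ε

/-- Almost periodic pattern. -/
def AlmostPeriodicPattern {n : ℕ} (Γ : Set (Fin n → ℝ)) : Prop :=
  Γ ⊆ intPoints n ∧ Delone Γ ∧
    ∀ ε > 0, ∃ Rε > 0, ∃ N : Set (Fin n → ℝ), IsEpsTranslationSet Γ ε Rε N

/-- `Γ` has uniform density `D`. -/
def HasUnifDensity {n : ℕ} (Γ : Set (Fin n → ℝ)) (D : ℝ) : Prop :=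
  ∀ ε > 0, ∃ R₀ > 0, ∀ R, R₀ ≤ R → ∀ x : Fin n → ℝ,
    |((Metric.ball x R ∩ Γ).ncard : ℝ) / ((Metric.ball x R ∩ intPoints n).ncard : ℝ) - D| ≤ ε

/-- `Γ ∩ (Γ - v)`, the set of `x ∈ Γ` with `x + v ∈ Γ`. -/
def diffSet {n : ℕ} (Γ : Set (Fin n → ℝ)) (v : Fin n → ℝ) : Set (Fin n → ℝ) :=
  Γ ∩ {x | x + v ∈ Γ}

/-- `E` is equidistributed modulo `ℤ^n`: averages of continuous `ℤ^n`-periodic functions over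
`E ∩ B_R` converge to the Haar integral. -/
def EquidistributedModZn {n : ℕ} (E : Set (Fin n → ℝ)) : Prop :=
  ∀ f : (Fin n → ℝ) → ℝ, Continuous f →
    (∀ (x : Fin n → ℝ) (v : Fin n → ℤ), f (x + intVec v) = f x) →
    Filter.Tendsto (fun R : ℝ =>
        (∑ᶠ x ∈ E ∩ Metric.ball (0 : Fin n → ℝ) R, f x) /
          ((E ∩ Metric.ball (0 : Fin n → ℝ) R).ncard : ℝ))
      Filter.atTop
      (nhds (∫ x in Set.pi Set.univ (fun _ : Fin n => Set.Ico (0:ℝ) 1), f x))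

/-- `P` is totally irrational: `P(ℤ^n)` is equidistributed modulo `ℤ^n`. -/
def TotallyIrrational {n : ℕ} (P : Matrix (Fin n) (Fin n) ℝ) : Prop :=
  EquidistributedModZn (P.mulVec '' intPoints n)

/-- Rate of injectivity in time 1. -/
def tauOne {n : ℕ} (P : Matrix (Fin n) (Fin n) ℝ) : ℝ :=
  Filter.limsup (fun R : ℝ =>
    ((PhatImg P (intPoints n) ∩ Metric.ball (0 : Fin n → ℝ) R).ncard : ℝ) /
      ((intPoints n ∩ Metric.ball (0 : Fin n → ℝ) R).ncard : ℝ)) Filter.atTop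

/-- The successive images `(P̂_k ∘ ⋯ ∘ P̂_1)(Γ)`. -/
def seqImg {n : ℕ} (P : ℕ → Matrix (Fin n) (Fin n) ℝ) :
    ℕ → Set (Fin n → ℝ) → Set (Fin n → ℝ)
  | 0, Γ => Γ
  | k + 1, Γ => PhatImg (P (k + 1)) (seqImg P k Γ)

/-- Rate of injectivity in time `k` of the sequence `(P_k)`. -/
def tauK {n : ℕ} (P : ℕ → Matrix (Fin n) (Fin n) ℝ) (k : ℕ) : ℝ :=
  Filter.limsup (fun R : ℝ =>
    ((seqImg P k (intPoints n) ∩ Metric.ball (0 : Fin n → ℝ) R).ncard : ℝ) /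
      ((intPoints n ∩ Metric.ball (0 : Fin n → ℝ) R).ncard : ℝ)) Filter.atTop

/-- A fixed norm on `M_n(ℝ)`: the sup of absolute values of the entries. -/
def matNorm {n : ℕ} (A : Matrix (Fin n) (Fin n) ℝ) : ℝ :=
  ⨆ p : Fin n × Fin n, |A p.1 p.2|


/-- The function `φ_u`, a "weighted projection" of `u` on `ℤ^n`. -/
def phiFn {n : ℕ} (u : Fin n → ℝ) (v : Fin n → ℤ) : ℝ :=
  if ‖u - intVec v‖ < 1 then ∏ i, (1 - |u i - (v i : ℝ)|) else 0

/-- `I_ℚ(A)`: the set of indices `i` such that all entries of the `i`-th row of `A`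
are rational. -/
def IQ {n : ℕ} (A : Matrix (Fin n) (Fin n) ℝ) : Set (Fin n) :=
  {i | ∀ j, ∃ q : ℚ, A i j = (q : ℝ)}

/-- A sequence of matrices all lying in `O_n(ℝ)`. -/
def IsOnSeq {n : ℕ} (P : ℕ → Matrix (Fin n) (Fin n) ℝ) : Prop :=
  ∀ k, P k ∈ Matrix.orthogonalGroup (Fin n) ℝ

/-- The `ℓ^∞` distance on sequences of matrices. -/
def seqDist {n : ℕ} (P Q : ℕ → Matrix (Fin n) (Fin n) ℝ) : ℝ :=
  ⨆ k : ℕ, matNorm (P k - Q k)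

/-- Open subsets of `ℓ^∞(O_n(ℝ))`. -/
def IsOpenSeq {n : ℕ} (U : Set {P : ℕ → Matrix (Fin n) (Fin n) ℝ // IsOnSeq P}) : Prop :=
  ∀ P ∈ U, ∃ δ > 0, ∀ Q : {P : ℕ → Matrix (Fin n) (Fin n) ℝ // IsOnSeq P},
    seqDist P.1 Q.1 < δ → Q ∈ U

/-- Dense subsets of `ℓ^∞(O_n(ℝ))`. -/
def IsDenseSeq {n : ℕ} (U : Set {P : ℕ → Matrix (Fin n) (Fin n) ℝ // IsOnSeq P}) : Prop :=
  ∀ P : {P : ℕ → Matrix (Fin n) (Fin n) ℝ // IsOnSeq P}, ∀ δ > 0,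
    ∃ Q ∈ U, seqDist P.1 Q.1 < δ

/-- Blichfeldt's theorem with multiplicity. -/
theorem exists_finset_card_eq_vadd_mem_of_lt_measure {L E : Type*} [AddGroup L] [Countable L]
    [AddAction L E] [MeasurableSpace E] {μ : Measure E} [MeasurableConstVAdd L E]
    [VAddInvariantMeasure L E μ] {F A : Set E} (fund : IsAddFundamentalDomain L F μ)
    (hA : MeasurableSet A) (k : ℕ) (h : k * μ F < μ A) :
    ∃ x : E, ∃ T : Finset L, T.card = k + 1 ∧ ∀ g ∈ T, g +ᵥ x ∈ A := by
  classical
  by_contra! hcon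
  refine absurd h (not_lt.2 ?_)
  have hle (x : E) : ∑' g : L, A.indicator (1 : E → ENNReal) (g +ᵥ x) ≤ k := by
    rw [ENNReal.tsum_eq_iSup_sum]
    refine iSup_le fun s => ?_
    simp only [Set.indicator_apply, Pi.one_apply, Finset.sum_boole, Nat.cast_le]
    by_contra! hlt
    obtain ⟨T, hT, hcard⟩ := Finset.exists_subset_card_eq (Nat.succ_le_of_lt hlt)
    obtain ⟨g, hg, hgA⟩ := hcon x T hcard
    exact hgA (Finset.mem_filter.1 (hT hg)).2
  calc μ A = ∫⁻ x, A.indicator 1 x ∂μ := (lintegral_indicator_one hA).symm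
    _ = ∑' g : L, ∫⁻ x in F, A.indicator 1 (g +ᵥ x) ∂μ := fund.lintegral_eq_tsum'' _
    _ = ∫⁻ x in F, ∑' g : L, A.indicator 1 (g +ᵥ x) ∂μ :=
        (lintegral_tsum fun g => ((measurable_one.indicator hA).comp
          (measurable_const_vadd g)).aemeasurable).symm
    _ ≤ ∫⁻ _ in F, k ∂μ := lintegral_mono hle
    _ = k * μ F := setLIntegral_const _ _

theorem intVec_injective {n : ℕ} : Function.Injective (intVec (n := n)) := fun v w h => by
  ext i
  have hi : (v i : ℝ) = w i := congrFun h i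
  exact_mod_cast hi

theorem intVec_add {n : ℕ} (v w : Fin n → ℤ) : intVec (v + w) = intVec v + intVec w := by
  ext i
  simp [intVec]

theorem intVec_sub {n : ℕ} (v w : Fin n → ℤ) : intVec (v - w) = intVec v - intVec w := by
  ext i
  simp [intVec]

theorem exists_finset_intVec_mem_of_lt_volume {n : ℕ} {A : Set (Fin n → ℝ)}
    (hA : MeasurableSet A) (k : ℕ) (h : k < volume A) :
    ∃ x : Fin n → ℝ, ∃ T : Finset (Fin n → ℤ), T.card = k + 1 ∧ ∀ t ∈ T, intVec t + x ∈ A := by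
  classical
  set b := Pi.basisFun ℝ (Fin n) with hb
  have hvol : volume (ZSpan.fundamentalDomain b) = 1 := by
    rw [hb, ZSpan.fundamentalDomain_pi_basisFun, volume_pi, Measure.pi_pi]
    simp
  have hint (g : (Submodule.span ℤ (Set.range b)).toAddSubgroup) :
      ∃ v : Fin n → ℤ, intVec v = (g : Fin n → ℝ) := by
    have hg := (b.mem_span_iff_repr_mem ℤ (g : Fin n → ℝ)).1 g.2
    choose v hv using hg
    exact ⟨v, funext fun i => by simpa [hb, intVec] using hv i⟩
  choose φ hφ using hint
  have hinj : Function.Injective φ := fun g g' hgg' =>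
    Subtype.ext <| by rw [← hφ g, ← hφ g', hgg']
  have := hinj.countable
  obtain ⟨x, T, hcard, hT⟩ := exists_finset_card_eq_vadd_mem_of_lt_measure
    (ZSpan.isAddFundamentalDomain' b volume) hA k (by rwa [hvol, mul_one])
  refine ⟨x, T.image φ, by rw [Finset.card_image_of_injective _ hinj, hcard], ?_⟩
  intro t ht
  obtain ⟨g, hg, rfl⟩ := Finset.mem_image.1 ht
  rw [hφ]
  exact hT g hg

open scoped Pointwise in
/-- A symmetric convex set of volume larger than `4 ^ n * k` contains all the differences of some set
of `2 * k + 1` integer points. -/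
theorem exists_finset_intVec_sub_mem_of_lt_volume {n : ℕ} {S : Set (Fin n → ℝ)}
    (hS : MeasurableSet S) (hconv : Convex ℝ S) (hsymm : S = -S) (k : ℕ)
    (h : (4 : ENNReal) ^ n * k < volume S) :
    ∃ T : Finset (Fin n → ℤ), T.card = 2 * k + 1 ∧
      ∀ t ∈ T, ∀ t' ∈ T, intVec (t' - t) ∈ S := by
  classical
  have hneg (x : Fin n → ℝ) (hx : x ∈ S) : -x ∈ S := by
    rw [hsymm]
    simpa using hx
  have hvol : (k : ENNReal) < volume ((4⁻¹ : ℝ) • S) := by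
    rw [Measure.addHaar_smul_of_nonneg volume (by simp : 0 ≤ (4 : ℝ)⁻¹) S, Module.finrank_fin_fun,
      ENNReal.ofReal_pow (by simp), ENNReal.ofReal_inv_of_pos (by simp), ENNReal.ofReal_ofNat,
      ← ENNReal.inv_pow, mul_comm, ← div_eq_mul_inv,
      ENNReal.lt_div_iff_mul_lt (by simp) (by simp), mul_comm]
    exact h
  obtain ⟨x, A, hcard, hA⟩ := exists_finset_intVec_mem_of_lt_volume
    (hS.const_smul_of_ne_zero (by norm_num : (4⁻¹ : ℝ) ≠ 0)) k hvol
  have hA' (a) (ha : a ∈ A) : (4 : ℝ) • (intVec a + x) ∈ S :=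
    (Set.mem_inv_smul_set_iff₀ (by norm_num) _ _).1 (hA a ha)
  have hne : A.Nonempty := Finset.card_pos.1 (by omega)
  have hcd := cauchy_davenport_of_isAddTorsionFree hne hne.neg
  rw [← sub_eq_add_neg, Finset.card_neg, hcard] at hcd
  obtain ⟨T, hT, hTcard⟩ := Finset.exists_subset_card_eq
    (show 2 * k + 1 ≤ (A - A).card by omega)
  refine ⟨T, hTcard, fun t ht t' ht' => ?_⟩
  obtain ⟨a, ha, b, hb, rfl⟩ := Finset.mem_sub.1 (hT ht)
  obtain ⟨c, hc, d, hd, rfl⟩ := Finset.mem_sub.1 (hT ht')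
  have h₁ := hconv (hA' c hc) (hneg _ (hA' d hd)) (by norm_num : (0 : ℝ) ≤ 1 / 2)
    (by norm_num : (0 : ℝ) ≤ 1 / 2) (by norm_num)
  have h₂ := hconv (hneg _ (hA' a ha)) (hA' b hb) (by norm_num : (0 : ℝ) ≤ 1 / 2)
    (by norm_num : (0 : ℝ) ≤ 1 / 2) (by norm_num)
  have h₃ := hconv h₁ h₂ (by norm_num : (0 : ℝ) ≤ 1 / 2)
    (by norm_num : (0 : ℝ) ≤ 1 / 2) (by norm_num)
  convert h₃ using 1
  simp only [intVec_sub]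
  module

theorem HasUnifDensity.tendsto {n : ℕ} {E : Set (Fin n → ℝ)} {D : ℝ} (h : HasUnifDensity E D)
    (x : Fin n → ℝ) :
    Tendsto (fun R => ((Metric.ball x R ∩ E).ncard : ℝ) /
        ((Metric.ball x R ∩ intPoints n).ncard : ℝ))
      atTop (nhds D) := by
  rw [Metric.tendsto_atTop]
  intro ε hε
  obtain ⟨R₀, -, hR₀⟩ := h (ε / 2) (half_pos hε)
  exact ⟨R₀, fun R hR => (hR₀ R hR x).trans_lt (half_lt_self hε)⟩

theorem finite_setOf_intVec_mem_ball {n : ℕ} (R : ℝ) :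
    {z : Fin n → ℤ | intVec z ∈ Metric.ball 0 R}.Finite := by
  refine (Set.finite_Icc (fun _ => -⌈R⌉) (fun _ => ⌈R⌉)).subset fun z hz => ?_
  have hz' : ‖intVec z‖ < R := by simpa using hz
  have hi (i : Fin n) : |(z i : ℝ)| ≤ ⌈R⌉ :=
    (norm_le_pi_norm (intVec z) i).trans (hz'.le.trans (Int.le_ceil R))
  refine ⟨fun i => ?_, fun i => ?_⟩
  · exact_mod_cast (abs_le.1 (hi i)).1
  · exact_mod_cast (abs_le.1 (hi i)).2

open scoped Classical in
theorem ncard_ball_intVec_inter {n : ℕ} {E : Set (Fin n → ℝ)} (hE : E ⊆ intPoints n)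
    (t : Fin n → ℤ) (R : ℝ) :
    (Metric.ball (intVec t) R ∩ E).ncard =
      ((finite_setOf_intVec_mem_ball R).toFinset.filter fun z => intVec (z + t) ∈ E).card := by
  rw [← Set.ncard_coe_finset, ← Set.ncard_image_of_injective _
    (intVec_injective.comp (add_left_injective t))]
  congr 1
  ext y
  simp only [Set.mem_inter_iff, Metric.mem_ball, Finset.coe_filter, Set.Finite.mem_toFinset,
    Set.mem_image, Set.mem_ofPred_eq, Function.comp_apply, dist_eq_norm, sub_zero]
  constructor
  · rintro ⟨hy, hyE⟩
    obtain ⟨w, rfl⟩ := hE hyE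
    refine ⟨w - t, ⟨by rwa [intVec_sub], by rwa [sub_add_cancel]⟩, by rw [sub_add_cancel]⟩
  · rintro ⟨z, ⟨hz, hzE⟩, rfl⟩
    exact ⟨by rwa [intVec_add, add_sub_cancel_right], hzE⟩

open scoped Classical in
theorem two_mul_sum_card_filter_le {α ι : Type*} (F : Finset α) (T : Finset ι)
    (p : ι → α → Prop) :
    2 * ∑ t ∈ T, (F.filter (p t)).card ≤
      2 * F.card + ∑ q ∈ T.offDiag, (F.filter fun z => p q.1 z ∧ p q.2 z).card := by
  simp only [Finset.card_filter, Finset.mul_sum]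
  rw [Finset.sum_comm, Finset.sum_comm (s := T.offDiag), Finset.card_eq_sum_ones, Finset.mul_sum,
    ← Finset.sum_add_distrib]
  refine Finset.sum_le_sum fun z _ => ?_
  have h₁ : ∑ q ∈ T.offDiag, (if p q.1 z ∧ p q.2 z then 1 else 0) =
      (T.filter (p · z)).offDiag.card := by
    rw [← Finset.card_filter]
    congr 1
    ext q
    simp only [Finset.mem_filter, Finset.mem_offDiag]
    tauto
  rw [h₁, ← Finset.mul_sum, ← Finset.card_filter, Finset.offDiag_card]
  generalize (T.filter (p · z)).card = m
  rcases m with _ | _ | m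
  · simp
  · simp
  · have : (m + 1 + 1) * (m + 1 + 1) - (m + 1 + 1) = (m + 1) * (m + 2) :=
      Nat.sub_eq_of_eq_add (by ring)
    rw [this]
    nlinarith

/-- Bonferroni inequality for the densities of the translates of `Γ`. -/
theorem two_mul_card_mul_density_le {n : ℕ} {Γ : Set (Fin n → ℝ)} (hΓ : Γ ⊆ intPoints n)
    {D : ℝ} (hD : HasUnifDensity Γ D) {ρ : (Fin n → ℤ) → ℝ}
    (hρ : ∀ v : Fin n → ℤ, HasUnifDensity (diffSet Γ (intVec v)) (ρ v * D))
    (T : Finset (Fin n → ℤ)) :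
    2 * (T.card * D) ≤ 2 + ∑ q ∈ T.offDiag, ρ (q.2 - q.1) * D := by
  classical
  have hT₁ : Tendsto (fun R => 2 * ∑ t ∈ T, ((Metric.ball (intVec t) R ∩ Γ).ncard : ℝ) /
      ((Metric.ball (intVec t) R ∩ intPoints n).ncard : ℝ)) atTop (nhds (2 * (T.card * D))) := by
    rw [← nsmul_eq_mul, ← Finset.sum_const]
    exact (tendsto_finsetSum _ fun t _ => hD.tendsto _).const_mul 2
  have hT₂ : Tendsto (fun R => 2 + ∑ q ∈ T.offDiag,
      ((Metric.ball (intVec q.1) R ∩ diffSet Γ (intVec (q.2 - q.1))).ncard : ℝ) /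
        ((Metric.ball (intVec q.1) R ∩ intPoints n).ncard : ℝ)) atTop
      (nhds (2 + ∑ q ∈ T.offDiag, ρ (q.2 - q.1) * D)) :=
    (tendsto_finsetSum _ fun q _ => (hρ _).tendsto _).const_add 2
  refine le_of_tendsto_of_tendsto' hT₁ hT₂ fun R => ?_
  set F := (finite_setOf_intVec_mem_ball (n := n) R).toFinset
  have hball (t : Fin n → ℤ) : (Metric.ball (intVec t) R ∩ intPoints n).ncard = F.card := by
    rw [ncard_ball_intVec_inter subset_rfl, Finset.filter_true_of_mem]
    exact fun z _ => ⟨_, rfl⟩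
  have hdiff (q : (Fin n → ℤ) × (Fin n → ℤ)) :
      (Metric.ball (intVec q.1) R ∩ diffSet Γ (intVec (q.2 - q.1))).ncard =
        (F.filter fun z => intVec (z + q.1) ∈ Γ ∧ intVec (z + q.2) ∈ Γ).card := by
    have hsub : diffSet Γ (intVec (q.2 - q.1)) ⊆ intPoints n := Set.inter_subset_left.trans hΓ
    rw [ncard_ball_intVec_inter hsub]
    simp only [diffSet, Set.mem_inter_iff, Set.mem_ofPred_eq, ← intVec_add]
    simp only [add_assoc, add_sub_cancel, F]
  simp only [hball, hdiff, ncard_ball_intVec_inter hΓ]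
  rw [← Finset.sum_div, ← Finset.sum_div, ← mul_div_assoc]
  have hle := two_mul_sum_card_filter_le F T fun t z => intVec (z + t) ∈ Γ
  rcases F.card.eq_zero_or_pos with h0 | hpos
  · simp [h0]
  · have hpos' : (0 : ℝ) < F.card := by exact_mod_cast hpos
    rw [div_le_iff₀ hpos', add_mul, div_mul_cancel₀ _ hpos'.ne']
    exact_mod_cast hle

/-- Minkowski-type theorem for almost periodic patterns. -/
theorem statement5 {n : ℕ} (Γ : Set (Fin n → ℝ)) (hΓ : AlmostPeriodicPattern Γ)
    (D : ℝ) (hD : HasUnifDensity Γ D) (hDpos : 0 < D)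
    (ρ : (Fin n → ℤ) → ℝ)
    (hρ : ∀ v : Fin n → ℤ, HasUnifDensity (diffSet Γ (intVec v)) (ρ v * D))
    (k : ℕ) (hk : 1 ≤ k)
    (S : Set (Fin n → ℝ)) (hScomp : IsCompact S) (hSconv : Convex ℝ S)
    (hSint : (interior S).Nonempty) (hSsymm : S = -S)
    (hvol : (4 : ENNReal) ^ n * k < MeasureTheory.volume S)
    (ρ₀ : ℝ) (hρ₀ : 0 < ρ₀)
    (hlt : ∀ v : Fin n → ℤ, v ≠ 0 → intVec v ∈ S → ρ v < ρ₀) :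
    (1 / (k : ℝ)) * (1 - 1 / (D * (2 * (k : ℝ) + 1))) ≤ ρ₀ := by
  obtain ⟨T, hcard, hT⟩ :=
    exists_finset_intVec_sub_mem_of_lt_volume hScomp.measurableSet hSconv hSsymm k hvol
  have hle := two_mul_card_mul_density_le hΓ.1 hD hρ T
  have hsum : ∑ q ∈ T.offDiag, ρ (q.2 - q.1) * D ≤ T.offDiag.card * (ρ₀ * D) := by
    rw [← nsmul_eq_mul]
    refine Finset.sum_le_card_nsmul _ _ _ fun q hq => ?_
    obtain ⟨h₁, h₂, hne⟩ := Finset.mem_offDiag.1 hq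
    exact mul_le_mul_of_nonneg_right
      (hlt _ (sub_ne_zero.2 hne.symm) (hT _ h₁ _ h₂)).le hDpos.le
  have hoff : T.offDiag.card = (2 * k + 1) * (2 * k) := by
    rw [Finset.offDiag_card, hcard]
    exact Nat.sub_eq_of_eq_add (by ring)
  rw [hoff] at hsum
  rw [hcard] at hle
  push_cast at hsum hle
  have hk' : (0 : ℝ) < k := by exact_mod_cast hk
  have hpos : 0 < D * (2 * (k : ℝ) + 1) := by positivity
  rw [one_div_mul_eq_div, div_le_iff₀ hk', sub_le_iff_le_add, ← sub_le_iff_le_add',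
    le_div_iff₀ hpos]
  linarith

end
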